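/- arXiv:1905.06278 — 5 statements merged into one kernel-verified Lean document; each statement's English description precedes it below -/
import Mathlib

section
/- There exists a constant C > 0 such that for all real numbers a ≥ 1 and N ≥ 1, one has |∑_{n ∈ ℤ², |n| ≤ N} 1/(a + |n|²) − π·log(1 + N²/a)| ≤ C · a^{-1/2} · min(1, N·a^{-1/2}). -/
open scoped BigOperators

/- The set of lattice points `n ∈ ℤ²` with Euclidean norm `|n| ≤ N`. -/
open scoped Classical in
noncomputable def latticeBall (N : ℝ) : Finset (ℤ × ℤ) :=
  (Finset.Icc (⌈-N⌉ : ℤ) ⌊N⌋ ×ˢ Finset.Icc (⌈-N⌉ : ℤ) ⌊N⌋).filter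
    fun n => ((n.1 : ℝ) ^ 2 + (n.2 : ℝ) ^ 2) ≤ N ^ 2

open MeasureTheory Set

lemma volume_floor_cell (n : ℤ × ℤ) :
    volume {z : ℂ | ⌊z.re⌋ = n.1 ∧ ⌊z.im⌋ = n.2} = 1 := by
  have h : {z : ℂ | ⌊z.re⌋ = n.1 ∧ ⌊z.im⌋ = n.2} = Complex.measurableEquivRealProd ⁻¹'
      (Ico (n.1 : ℝ) (n.1 + 1) ×ˢ Ico (n.2 : ℝ) (n.2 + 1)) := by
    ext z
    simp [Int.floor_eq_iff, Complex.measurableEquivRealProd]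
  rw [h, Complex.volume_preserving_equiv_real_prod.measure_preimage
    (measurableSet_Ico.prod measurableSet_Ico).nullMeasurableSet, Measure.volume_eq_prod,
    Measure.prod_prod]
  simp

lemma measurableSet_floor_cell (n : ℤ × ℤ) :
    MeasurableSet {z : ℂ | ⌊z.re⌋ = n.1 ∧ ⌊z.im⌋ = n.2} := by
  have h1 : Measurable fun z : ℂ => ⌊z.re⌋ := Int.measurable_floor.comp Complex.measurable_re
  have h2 : Measurable fun z : ℂ => ⌊z.im⌋ := Int.measurable_floor.comp Complex.measurable_im
  exact (h1 (measurableSet_singleton n.1)).inter (h2 (measurableSet_singleton n.2))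

/-- The region tiled by the unit cells with lower left corner in `B` has area `#B`. -/
lemma volume_floor_mem (B : Finset (ℤ × ℤ)) :
    volume {z : ℂ | (⌊z.re⌋, ⌊z.im⌋) ∈ B} = B.card := by
  have h : {z : ℂ | (⌊z.re⌋, ⌊z.im⌋) ∈ B} =
      ⋃ n ∈ B, {z : ℂ | ⌊z.re⌋ = n.1 ∧ ⌊z.im⌋ = n.2} := by
    ext z
    simp only [mem_ofPred_eq, mem_iUnion, exists_prop]
    constructor
    · intro hz
      exact ⟨_, hz, rfl, rfl⟩
    · rintro ⟨n, hn, h1, h2⟩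
      rwa [h1, h2]
  rw [h, measure_biUnion_finset]
  · simp [volume_floor_cell]
  · intro m _ n _ hmn
    refine Set.disjoint_left.2 fun z hz hz' => hmn ?_
    exact Prod.ext (hz.1.symm.trans hz'.1) (hz.2.symm.trans hz'.2)
  · exact fun n _ => measurableSet_floor_cell n

lemma norm_sub_floor_le (z : ℂ) : ‖z - (⟨⌊z.re⌋, ⌊z.im⌋⟩ : ℂ)‖ ≤ 2 := by
  refine (Complex.norm_le_abs_re_add_abs_im _).trans ?_
  simp only [Complex.sub_re, Complex.sub_im, Int.self_sub_floor, Int.abs_fract]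
  linarith [Int.fract_lt_one z.re, Int.fract_lt_one z.im]

lemma norm_mk_sq (x y : ℝ) : ‖(⟨x, y⟩ : ℂ)‖ ^ 2 = x ^ 2 + y ^ 2 := by
  rw [Complex.sq_norm, Complex.normSq_mk]; ring

/-- Gauss's bound for the number of lattice points in a disc, with any part of the boundary
circle included. -/
lemma abs_card_sub_pi_mul_sq_le (B : Finset (ℤ × ℤ)) {r : ℝ} (hr : 0 ≤ r)
    (h_lt : ∀ n : ℤ × ℤ, (n.1 : ℝ) ^ 2 + (n.2 : ℝ) ^ 2 < r ^ 2 → n ∈ B)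
    (h_le : ∀ n ∈ B, (n.1 : ℝ) ^ 2 + (n.2 : ℝ) ^ 2 ≤ r ^ 2) :
    |(B.card : ℝ) - Real.pi * r ^ 2| ≤ 16 * (1 + r) := by
  have hpi := Real.pi_le_four
  have hpi0 := Real.pi_pos
  have upper : (B.card : ℝ) ≤ Real.pi * (r + 2) ^ 2 := by
    have hsub : {z : ℂ | (⌊z.re⌋, ⌊z.im⌋) ∈ B} ⊆ Metric.closedBall 0 (r + 2) := by
      intro z hz
      have h1 := h_le _ hz
      rw [← norm_mk_sq] at h1
      have h2 := (sq_le_sq₀ (norm_nonneg _) hr).1 h1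
      have h3 := norm_sub_floor_le z
      have h4 := norm_le_norm_add_norm_sub' z (⟨⌊z.re⌋, ⌊z.im⌋⟩ : ℂ)
      rw [mem_closedBall_zero_iff]
      linarith
    have h := measure_mono (μ := volume) hsub
    rw [volume_floor_mem, Complex.volume_closedBall] at h
    have h' := ENNReal.toReal_mono (by finiteness) h
    rw [ENNReal.toReal_mul, ENNReal.toReal_pow, ENNReal.toReal_ofReal (by linarith)] at h'
    simp at h'
    linarith
  have lower : 2 ≤ r → Real.pi * (r - 2) ^ 2 ≤ B.card := by
    intro h2r
    have hsub : Metric.ball 0 (r - 2) ⊆ {z : ℂ | (⌊z.re⌋, ⌊z.im⌋) ∈ B} := by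
      intro z hz
      rw [mem_ball_zero_iff] at hz
      apply h_lt
      rw [← norm_mk_sq]
      have h3 := norm_sub_floor_le z
      have h4 := norm_le_norm_add_norm_sub z (⟨⌊z.re⌋, ⌊z.im⌋⟩ : ℂ)
      exact pow_lt_pow_left₀ (by linarith) (norm_nonneg _) two_ne_zero
    have h := measure_mono (μ := volume) hsub
    rw [volume_floor_mem, Complex.volume_ball] at h
    have h' := ENNReal.toReal_mono (by finiteness) h
    rw [ENNReal.toReal_mul, ENNReal.toReal_pow, ENNReal.toReal_ofReal (by linarith)] at h'
    simp at h'
    linarith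
  rw [abs_le]
  constructor
  · rcases le_total 2 r with h | h
    · nlinarith [lower h]
    · have : (0 : ℝ) ≤ B.card := by positivity
      nlinarith [mul_nonneg hr (sub_nonneg.2 h), mul_nonneg hpi0.le hr]
  · nlinarith

lemma mem_latticeBall {N : ℝ} (hN : 0 ≤ N) (n : ℤ × ℤ) :
    n ∈ latticeBall N ↔ (n.1 : ℝ) ^ 2 + (n.2 : ℝ) ^ 2 ≤ N ^ 2 := by
  simp only [latticeBall, Finset.mem_filter, Finset.mem_product, Finset.mem_Icc, Int.ceil_le,
    Int.le_floor, and_iff_right_iff_imp]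
  intro h
  have h1 := abs_le_of_sq_le_sq (show (n.1 : ℝ) ^ 2 ≤ N ^ 2 by nlinarith [sq_nonneg (n.2 : ℝ)]) hN
  have h2 := abs_le_of_sq_le_sq (show (n.2 : ℝ) ^ 2 ≤ N ^ 2 by nlinarith [sq_nonneg (n.1 : ℝ)]) hN
  exact ⟨abs_le.1 h1, abs_le.1 h2⟩

lemma integral_inv_add_sq {a p q : ℝ} (ha : 0 < a) (hp : 0 ≤ p) (hpq : p ≤ q) :
    ∫ t in p..q, 1 / (a + t) ^ 2 = 1 / (a + p) - 1 / (a + q) := by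
  have hpos : ∀ t ∈ uIcc p q, 0 < a + t := fun t ht => by
    rw [uIcc_of_le hpq] at ht; linarith [ht.1]
  rw [intervalIntegral.integral_eq_sub_of_hasDerivAt (f := fun t => -(a + t)⁻¹)]
  · ring
  · intro t ht
    have h := (((hasDerivAt_id t).const_add a).inv (hpos t ht).ne').neg
    refine h.congr_deriv ?_
    simp only [id]
    ring
  · refine ContinuousOn.intervalIntegrable fun t ht => ?_
    have := hpos t ht
    exact ContinuousAt.continuousWithinAt (by fun_prop (disch := positivity))

lemma integral_div_add_sq {a q : ℝ} (ha : 0 < a) (hq : 0 ≤ q) :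
    ∫ t in (0 : ℝ)..q, t / (a + t) ^ 2 = Real.log (1 + q / a) - q / (a + q) := by
  have hpos : ∀ t ∈ uIcc 0 q, 0 < a + t := fun t ht => by
    rw [uIcc_of_le hq] at ht; linarith [ht.1]
  rw [intervalIntegral.integral_eq_sub_of_hasDerivAt
    (f := fun t => Real.log (a + t) + a * (a + t)⁻¹)]
  · have : 1 + q / a = (a + q) / a := by field_simp
    rw [this, Real.log_div (by positivity) (by positivity)]
    simp only [add_zero]
    field_simp
    ring
  · intro t ht
    have h0 := hpos t ht
    have h := (((hasDerivAt_id t).const_add a).log h0.ne').add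
      ((((hasDerivAt_id t).const_add a).inv h0.ne').const_mul a)
    refine h.congr_deriv ?_
    simp only [id]
    field_simp
    ring
  · refine ContinuousOn.intervalIntegrable fun t ht => ?_
    have := hpos t ht
    exact ContinuousAt.continuousWithinAt (by fun_prop (disch := positivity))

lemma integral_inv_mul_sqrt {a q : ℝ} (ha : 0 < a) (hq : 0 ≤ q) :
    IntervalIntegrable (fun t => 1 / ((a + t) * √(a + t))) volume 0 q ∧
    ∫ t in (0 : ℝ)..q, 1 / ((a + t) * √(a + t)) = 2 * (√a)⁻¹ - 2 * (√(a + q))⁻¹ := by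
  have hpos : ∀ t ∈ uIcc 0 q, 0 < a + t := fun t ht => by
    rw [uIcc_of_le hq] at ht; linarith [ht.1]
  have hint : IntervalIntegrable (fun t => 1 / ((a + t) * √(a + t))) volume 0 q := by
    refine ContinuousOn.intervalIntegrable fun t ht => ?_
    have := hpos t ht
    exact ContinuousAt.continuousWithinAt (by fun_prop (disch := positivity))
  refine ⟨hint, ?_⟩
  rw [intervalIntegral.integral_eq_sub_of_hasDerivAt (f := fun t => -2 * (√(a + t))⁻¹) _ hint]
  · simp; ring
  · intro t ht
    have h0 := hpos t ht
    have h1 : √(a + t) ≠ 0 := (Real.sqrt_pos.2 h0).ne'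
    have h := ((((hasDerivAt_id t).const_add a).sqrt h0.ne').inv h1).const_mul (-2)
    refine h.congr_deriv ?_
    simp only [id, Real.sq_sqrt h0.le]
    field_simp

/-- Abel summation for `1 / (a + q n)`, in integral form. -/
lemma sum_one_div_add_eq {ι : Type*} (B : Finset ι) (q : ι → ℝ) {a M : ℝ} (ha : 0 < a)
    (hM : 0 ≤ M) (hq0 : ∀ n ∈ B, 0 ≤ q n) (hqM : ∀ n ∈ B, q n ≤ M) :
    IntervalIntegrable (fun t => ((B.filter (fun n => q n < t)).card : ℝ) * (1 / (a + t) ^ 2))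
      volume 0 M ∧
    ∑ n ∈ B, 1 / (a + q n) = B.card * (1 / (a + M)) +
      ∫ t in (0 : ℝ)..M, ((B.filter (fun n => q n < t)).card : ℝ) * (1 / (a + t) ^ 2) := by
  have hg : IntegrableOn (fun t => 1 / (a + t) ^ 2) (Ioc 0 M) := by
    rw [← intervalIntegrable_iff_integrableOn_Ioc_of_le hM]
    refine ContinuousOn.intervalIntegrable fun t ht => ?_
    have : 0 < a + t := by rw [uIcc_of_le hM] at ht; linarith [ht.1]
    exact ContinuousAt.continuousWithinAt (by fun_prop (disch := positivity))
  have heq : (fun t => ((B.filter (fun n => q n < t)).card : ℝ) * (1 / (a + t) ^ 2)) =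
      fun t => ∑ n ∈ B, (Ioi (q n)).indicator (fun t => 1 / (a + t) ^ 2) t := by
    ext t
    simp only [indicator_apply, mem_Ioi, ← Finset.sum_filter, Finset.sum_const, nsmul_eq_mul]
  have hi : ∀ n ∈ B, IntegrableOn ((Ioi (q n)).indicator fun t => 1 / (a + t) ^ 2) (Ioc 0 M) :=
    fun n _ => hg.indicator measurableSet_Ioi
  rw [heq]
  constructor
  · rw [intervalIntegrable_iff_integrableOn_Ioc_of_le hM]
    exact integrable_finsetSum _ hi
  · rw [intervalIntegral.integral_of_le hM, integral_finsetSum _ hi, ← nsmul_eq_mul,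
      ← Finset.sum_const, ← Finset.sum_add_distrib]
    refine Finset.sum_congr rfl fun n hn => ?_
    rw [setIntegral_indicator measurableSet_Ioi, Ioc_inter_Ioi, sup_eq_right.2 (hq0 n hn),
      ← intervalIntegral.integral_of_le (hqM n hn), integral_inv_add_sq ha (hq0 n hn) (hqM n hn)]
    ring

theorem stmt0 :
    ∃ C > (0 : ℝ), ∀ a N : ℝ, 1 ≤ a → 1 ≤ N →
      |(∑ n ∈ latticeBall N, 1 / (a + ((n.1 : ℝ) ^ 2 + (n.2 : ℝ) ^ 2)))
          - Real.pi * Real.log (1 + N ^ 2 / a)|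
        ≤ C * (Real.sqrt a)⁻¹ * min 1 (N * (Real.sqrt a)⁻¹) := by
  refine ⟨96, by norm_num, fun a N ha hN => ?_⟩
  have ha0 : 0 < a := by linarith
  have hN0 : 0 ≤ N := by linarith
  have hM : 0 ≤ N ^ 2 := by positivity
  obtain ⟨hint, hsum⟩ := sum_one_div_add_eq (latticeBall N)
    (fun n => (n.1 : ℝ) ^ 2 + (n.2 : ℝ) ^ 2) ha0 hM (fun n _ => by positivity)
    (fun n hn => (mem_latticeBall hN0 n).1 hn)
  have hlog := integral_div_add_sq ha0 hM
  have hint' : IntervalIntegrable (fun t => Real.pi * (t / (a + t) ^ 2)) volume 0 (N ^ 2) := by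
    refine ContinuousOn.intervalIntegrable fun t ht => ?_
    have : 0 < a + t := by rw [uIcc_of_le hM] at ht; linarith [ht.1]
    exact ContinuousAt.continuousWithinAt (by fun_prop (disch := positivity))
  set F : ℝ → ℝ := fun t => (((latticeBall N).filter
    (fun n => (n.1 : ℝ) ^ 2 + (n.2 : ℝ) ^ 2 < t)).card : ℝ) * (1 / (a + t) ^ 2)
  have hdecomp : (∑ n ∈ latticeBall N, 1 / (a + ((n.1 : ℝ) ^ 2 + (n.2 : ℝ) ^ 2)))
        - Real.pi * Real.log (1 + N ^ 2 / a) =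
      ((latticeBall N).card - Real.pi * N ^ 2) / (a + N ^ 2) +
        ∫ t in (0 : ℝ)..N ^ 2, (F t - Real.pi * (t / (a + t) ^ 2)) := by
    rw [intervalIntegral.integral_sub hint hint', intervalIntegral.integral_const_mul, hlog, hsum]
    ring
  have hpt : ∀ t ∈ Ioc 0 (N ^ 2), ‖F t - Real.pi * (t / (a + t) ^ 2)‖ ≤
      16 * (1 + √t) * (1 / (a + t) ^ 2) := by
    intro t ht
    have hc := abs_card_sub_pi_mul_sq_le ((latticeBall N).filter
      (fun n => (n.1 : ℝ) ^ 2 + (n.2 : ℝ) ^ 2 < t)) (Real.sqrt_nonneg t)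
      (fun n hn => by
        rw [Real.sq_sqrt ht.1.le] at hn
        exact Finset.mem_filter.2 ⟨(mem_latticeBall hN0 n).2 (hn.le.trans ht.2), hn⟩)
      (fun n hn => by
        rw [Real.sq_sqrt ht.1.le]
        exact (Finset.mem_filter.1 hn).2.le)
    rw [Real.sq_sqrt ht.1.le] at hc
    have h : F t - Real.pi * (t / (a + t) ^ 2) = ((((latticeBall N).filter
        (fun n => (n.1 : ℝ) ^ 2 + (n.2 : ℝ) ^ 2 < t)).card : ℝ) - Real.pi * t) *
          (1 / (a + t) ^ 2) := by
      simp only [F]; ring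
    rw [h, norm_mul, Real.norm_eq_abs, Real.norm_of_nonneg (by positivity : 0 ≤ 1 / (a + t) ^ 2)]
    gcongr
  have hsa : 0 < √a := Real.sqrt_pos.2 ha0
  have hsq : √a * √a = a := Real.mul_self_sqrt ha0.le
  have hinv : (√a)⁻¹ * (√a)⁻¹ = 1 / a := by rw [← mul_inv, hsq, one_div]
  have hbdry : |((latticeBall N).card - Real.pi * N ^ 2) / (a + N ^ 2)| ≤
      32 * (N / (a + N ^ 2)) := by
    have hc := abs_card_sub_pi_mul_sq_le (latticeBall N) hN0
      (fun n hn => (mem_latticeBall hN0 n).2 hn.le) (fun n hn => (mem_latticeBall hN0 n).1 hn)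
    rw [abs_div, abs_of_pos (by positivity : 0 < a + N ^ 2), ← mul_div_assoc]
    gcongr
    linarith
  have hb1 : N / (a + N ^ 2) ≤ (√a)⁻¹ := by
    rw [div_le_iff₀ (by positivity), inv_mul_eq_div, le_div_iff₀ hsa]
    nlinarith [sq_nonneg (N - √a)]
  have hb2 : N / (a + N ^ 2) ≤ N * (1 / a) := by
    rw [mul_one_div]
    gcongr
    linarith
  have hI1 : |∫ t in (0 : ℝ)..N ^ 2, (F t - Real.pi * (t / (a + t) ^ 2))| ≤ 64 * (√a)⁻¹ := by
    obtain ⟨hi, he⟩ := integral_inv_mul_sqrt ha0 hM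
    have h := intervalIntegral.norm_integral_le_of_norm_le hM (μ := volume)
      (f := fun t => F t - Real.pi * (t / (a + t) ^ 2))
      (g := fun t => 32 * (1 / ((a + t) * √(a + t)))) (ae_of_all _ fun t ht => ?_)
      (hi.const_mul 32)
    · rw [intervalIntegral.integral_const_mul, he] at h
      have : 0 ≤ (√(a + N ^ 2))⁻¹ := by positivity
      exact h.trans (by linarith)
    · refine (hpt t ht).trans ?_
      have h0 : 0 < a + t := by linarith [ht.1]
      have hs : 1 + √t ≤ 2 * √(a + t) := by
        have h1 : 1 ≤ √(a + t) := Real.one_le_sqrt.2 (by linarith [ht.1])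
        have h2 : √t ≤ √(a + t) := Real.sqrt_le_sqrt (by linarith)
        linarith
      have hse : √(a + t) * (1 / (a + t) ^ 2) = 1 / ((a + t) * √(a + t)) := by
        have h3 := Real.sqrt_pos.2 h0
        field_simp
        rw [Real.sq_sqrt h0.le]
      calc 16 * (1 + √t) * (1 / (a + t) ^ 2)
          ≤ 16 * (2 * √(a + t)) * (1 / (a + t) ^ 2) := by gcongr
        _ = 32 * (1 / ((a + t) * √(a + t))) := by rw [← hse]; ring
  have hI2 : |∫ t in (0 : ℝ)..N ^ 2, (F t - Real.pi * (t / (a + t) ^ 2))| ≤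
      32 * (N * (1 / a)) := by
    have hi : IntervalIntegrable (fun t => 1 / (a + t) ^ 2) volume 0 (N ^ 2) := by
      refine ContinuousOn.intervalIntegrable fun t ht => ?_
      have : 0 < a + t := by rw [uIcc_of_le hM] at ht; linarith [ht.1]
      exact ContinuousAt.continuousWithinAt (by fun_prop (disch := positivity))
    have h := intervalIntegral.norm_integral_le_of_norm_le hM (μ := volume)
      (f := fun t => F t - Real.pi * (t / (a + t) ^ 2))
      (g := fun t => 32 * N * (1 / (a + t) ^ 2)) (ae_of_all _ fun t ht => ?_)
      (hi.const_mul _)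
    · rw [intervalIntegral.integral_const_mul, integral_inv_add_sq ha0 le_rfl hM, add_zero] at h
      have h2 : 0 ≤ N * (1 / (a + N ^ 2)) := by positivity
      exact h.trans (by linarith)
    · refine (hpt t ht).trans ?_
      have hs : √t ≤ N := Real.sqrt_le_iff.2 ⟨hN0, ht.2⟩
      exact mul_le_mul_of_nonneg_right (by linarith) (by positivity)
  have h1 : 96 * (√a)⁻¹ * 1 = 96 * (√a)⁻¹ := mul_one _
  have h2 : 96 * (√a)⁻¹ * (N * (√a)⁻¹) = 96 * (N * (1 / a)) := by rw [← hinv]; ring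
  have h3 : 0 ≤ N * (1 / a) := by positivity
  rw [hdecomp, mul_min_of_nonneg _ _ (by positivity), h1, h2]
  refine (abs_add_le _ _).trans (le_min ?_ ?_)
  · linarith
  · linarith
end

section
/- For every positive integer N and every nonzero real number α, there exists a unique real number λ > 0 satisfying λ = (3α²/(8π²)) · ∑_{n ∈ ℤ², |n| ≤ N} 1/(λ + |n|²). -/
open scoped BigOperators

/-- The fixed-point equation `x = c * ∑ 1 / (x + w i)` with `c > 0` and nonnegative weights, one of
which vanishes, has exactly one positive solution. -/
theorem existsUnique_pos_eq_mul_sum_one_div_add {ι : Type*} (s : Finset ι) (w : ι → ℝ)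
    (hw : ∀ i ∈ s, 0 ≤ w i) (h0 : ∃ i ∈ s, w i = 0) {c : ℝ} (hc : 0 < c) :
    ∃! x : ℝ, 0 < x ∧ x = c * ∑ i ∈ s, 1 / (x + w i) := by
  set F : ℝ → ℝ := fun x => c * ∑ i ∈ s, 1 / (x + w i) with hF
  have anti : ∀ x y : ℝ, 0 < x → x ≤ y → F y ≤ F x := by
    intro x y hx hxy
    refine mul_le_mul_of_nonneg_left (Finset.sum_le_sum fun i hi => ?_) hc.le
    exact one_div_le_one_div_of_le (by linarith [hw i hi]) (by linarith)
  have hr : 0 < √c := Real.sqrt_pos.2 hc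
  set b : ℝ := √c + 1 + c * s.card with hb
  have hab : √c ≤ b := by
    have : 0 ≤ c * (s.card : ℝ) := by positivity
    linarith
  have lower : √c ≤ F √c := by
    obtain ⟨j, hj, hwj⟩ := h0
    have hsum : 1 / √c ≤ ∑ i ∈ s, 1 / (√c + w i) := by
      have := Finset.single_le_sum (f := fun i => 1 / (√c + w i))
        (fun i hi => one_div_nonneg.2 (by linarith [hw i hi])) hj
      simpa [hwj] using this
    calc √c = c * (1 / √c) := by rw [mul_one_div, Real.div_sqrt]
      _ ≤ F √c := mul_le_mul_of_nonneg_left hsum hc.le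
  have upper : F b ≤ b := by
    have hb1 : 1 ≤ b := by
      have : 0 ≤ c * (s.card : ℝ) := by positivity
      linarith
    have hsum : ∑ i ∈ s, 1 / (b + w i) ≤ s.card := by
      have := Finset.sum_le_card_nsmul s (fun i => 1 / (b + w i)) 1 fun i hi =>
        (div_le_one (by linarith [hw i hi])).2 (by linarith [hw i hi])
      simpa using this
    have : F b ≤ c * s.card := mul_le_mul_of_nonneg_left hsum hc.le
    linarith
  have cont : ContinuousOn (fun x => x - F x) (Set.Icc √c b) := by
    refine continuousOn_id.sub (continuousOn_const.mul (continuousOn_finsetSum s fun i hi => ?_))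
    refine continuousOn_const.div (continuousOn_id.add continuousOn_const) fun x hx => ?_
    exact (add_pos_of_pos_of_nonneg (hr.trans_le hx.1) (hw i hi)).ne'
  obtain ⟨x, hx, hfx⟩ := intermediate_value_Icc hab cont
    (show (0 : ℝ) ∈ Set.Icc _ _ from ⟨sub_nonpos.2 lower, sub_nonneg.2 upper⟩)
  have hx0 : 0 < x := hr.trans_le hx.1
  have hxF : x = F x := sub_eq_zero.1 hfx
  refine ⟨x, ⟨hx0, hxF⟩, fun y ⟨hy0, hyF⟩ => ?_⟩
  change y = F y at hyF
  rcases le_total x y with h | h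
  · linarith [anti x y hx0 h]
  · linarith [anti y x hy0 h]

theorem stmt1 (N : ℕ) (hN : 0 < N) (α : ℝ) (hα : α ≠ 0) :
    ∃! lam : ℝ, 0 < lam ∧
      lam = (3 * α ^ 2 / (8 * Real.pi ^ 2)) *
        ∑ n ∈ latticeBall (N : ℝ), 1 / (lam + ((n.1 : ℝ) ^ 2 + (n.2 : ℝ) ^ 2)) := by
  have hc : 0 < 3 * α ^ 2 / (8 * Real.pi ^ 2) := by positivity
  refine existsUnique_pos_eq_mul_sum_one_div_add (latticeBall (N : ℝ))
    (fun n => (n.1 : ℝ) ^ 2 + (n.2 : ℝ) ^ 2) (fun n _ => by positivity) ⟨(0, 0), ?_, by simp⟩ hc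
  simp [latticeBall, Int.ceil_le]
end

section
/- Let (α_N)_{N ∈ ℕ} be a bounded sequence of nonzero real numbers such that α_N² · log N → ∞ as N → ∞, and for each N let λ_N > 0 be the unique positive solution of λ_N = (3α_N²/(8π²)) · ∑_{n ∈ ℤ², |n| ≤ N} 1/(λ_N + |n|²). Then there exist constants c, C > 0 and N₀ ≥ 2 such that for all N ≥ N₀, c · α_N² · log N ≤ λ_N ≤ C · α_N² · log N. In particular λ_N → ∞ as N → ∞. -/
open scoped BigOperators

theorem mem_latticeBall_natCast {N : ℕ} {n : ℤ × ℤ} :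
    n ∈ latticeBall (N : ℝ) ↔ (n.1 : ℝ) ^ 2 + (n.2 : ℝ) ^ 2 ≤ (N : ℝ) ^ 2 := by
  simp only [latticeBall, Finset.mem_filter, Finset.mem_product, Finset.mem_Icc,
    Int.ceil_le, Int.le_floor, and_iff_right_iff_imp]
  intro h
  have hN : (0 : ℝ) ≤ N := N.cast_nonneg
  have h1 := abs_le_of_sq_le_sq' (by nlinarith [sq_nonneg (n.2 : ℝ)] : (n.1 : ℝ) ^ 2 ≤ N ^ 2) hN
  have h2 := abs_le_of_sq_le_sq' (by nlinarith [sq_nonneg (n.1 : ℝ)] : (n.2 : ℝ) ^ 2 ≤ N ^ 2) hN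
  exact ⟨h1, h2⟩

theorem sq_le_normSq_of_mem_box {k : ℕ} {n : ℤ × ℤ} (hn : n ∈ Finset.box (α := ℤ × ℤ) k) :
    (k : ℝ) ^ 2 ≤ (n.1 : ℝ) ^ 2 + (n.2 : ℝ) ^ 2 ∧
      (n.1 : ℝ) ^ 2 + (n.2 : ℝ) ^ 2 ≤ 2 * (k : ℝ) ^ 2 := by
  rw [Int.mem_box] at hn
  have e (a : ℤ) : (a : ℝ) ^ 2 = (a.natAbs : ℝ) ^ 2 := by
    rw [Nat.cast_natAbs, Int.cast_abs, sq_abs]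
  rw [e n.1, e n.2]
  norm_cast
  subst hn
  rcases le_total n.1.natAbs n.2.natAbs with h | h
  · rw [max_eq_right h]
    have := Nat.pow_le_pow_left h 2
    exact ⟨by linarith [Nat.zero_le (n.1.natAbs ^ 2)], by linarith⟩
  · rw [max_eq_left h]
    have := Nat.pow_le_pow_left h 2
    exact ⟨by linarith [Nat.zero_le (n.2.natAbs ^ 2)], by linarith⟩

theorem pairwiseDisjoint_box (s : Set ℕ) :
    s.PairwiseDisjoint (Finset.box : ℕ → Finset (ℤ × ℤ)) := by
  intro i _ j _ hij
  refine Finset.disjoint_left.2 fun x hi hj => hij ?_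
  rw [Int.mem_box] at hi hj
  exact hi.symm.trans hj

theorem sum_latticeBall_le {N : ℕ} (l : ℝ) (hl : 0 < l) :
    ∑ n ∈ latticeBall (N : ℝ), 1 / (l + ((n.1 : ℝ) ^ 2 + (n.2 : ℝ) ^ 2)) ≤
      1 / l + 8 * (1 + Real.log N) := by
  have hsub : latticeBall (N : ℝ) ⊆
      (Finset.range (N + 1)).biUnion (Finset.box : ℕ → Finset (ℤ × ℤ)) := by
    intro n hn
    rw [mem_latticeBall_natCast] at hn
    simp only [Finset.mem_biUnion, Finset.mem_range]
    refine ⟨max n.1.natAbs n.2.natAbs, ?_, Int.mem_box.2 rfl⟩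
    have h := (sq_le_normSq_of_mem_box (n := n) (Int.mem_box.2 rfl)).1.trans hn
    exact Nat.lt_succ_of_le (by
      exact_mod_cast (le_abs_self _).trans (abs_le_of_sq_le_sq h N.cast_nonneg))
  have hbox (k : ℕ) : ∑ n ∈ Finset.box (α := ℤ × ℤ) (k + 1),
      1 / (l + ((n.1 : ℝ) ^ 2 + (n.2 : ℝ) ^ 2)) ≤ 8 * ((k + 1 : ℕ) : ℝ)⁻¹ := by
    have hk : (0 : ℝ) < ((k + 1 : ℕ) : ℝ) := by positivity
    refine (Finset.sum_le_card_nsmul _ _ (1 / ((k + 1 : ℕ) : ℝ) ^ 2) fun n hn => ?_).trans_eq ?_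
    · exact one_div_le_one_div_of_le (by positivity)
        (by linarith [(sq_le_normSq_of_mem_box hn).1])
    · rw [Int.card_box k.succ_ne_zero, nsmul_eq_mul]
      push_cast at hk ⊢
      field_simp
  have hH := harmonic_le_one_add_log N
  calc _ ≤ ∑ n ∈ (Finset.range (N + 1)).biUnion (Finset.box : ℕ → Finset (ℤ × ℤ)),
        1 / (l + ((n.1 : ℝ) ^ 2 + (n.2 : ℝ) ^ 2)) :=
        Finset.sum_le_sum_of_subset_of_nonneg hsub fun _ _ _ => by positivity
    _ = ∑ k ∈ Finset.range (N + 1), ∑ n ∈ Finset.box (α := ℤ × ℤ) k,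
        1 / (l + ((n.1 : ℝ) ^ 2 + (n.2 : ℝ) ^ 2)) :=
        Finset.sum_biUnion (pairwiseDisjoint_box _)
    _ ≤ ∑ k ∈ Finset.range N, 8 * ((k + 1 : ℕ) : ℝ)⁻¹ + 1 / l := by
        rw [Finset.sum_range_succ']
        gcongr with k
        · exact hbox k
        · simp
    _ = 1 / l + 8 * (harmonic N : ℝ) := by
        rw [← Finset.mul_sum, harmonic]
        push_cast
        ring
    _ ≤ _ := by gcongr

theorem le_sum_latticeBall {N : ℕ} (l : ℝ) (hl : 0 < l) (hlN : l ≤ N) (hN : 8 ≤ Real.log N) :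
    2 / 3 * Real.log N ≤
      ∑ n ∈ latticeBall (N : ℝ), 1 / (l + ((n.1 : ℝ) ^ 2 + (n.2 : ℝ) ^ 2)) := by
  have hN0 : (0 : ℝ) < N := hl.trans_le hlN
  obtain ⟨s, hs0, h2s, hsN, hNs⟩ : ∃ s : ℕ, 0 < s ∧ s ≤ N / 2 ∧ s ^ 2 ≤ N ∧
      N < (s + 1) * (s + 1) := by
    have hlogN := Real.log_le_sub_one_of_pos hN0
    have h4 : 4 ≤ N := by exact_mod_cast (by linarith : (4 : ℝ) ≤ N)
    have h2 : 2 ≤ N.sqrt := Nat.le_sqrt.2 (by omega)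
    have h5 : N.sqrt * N.sqrt ≤ N := Nat.sqrt_le N
    refine ⟨N.sqrt, by omega, ?_, Nat.sqrt_le' N, Nat.lt_succ_sqrt N⟩
    rw [Nat.le_div_iff_mul_le two_pos]
    nlinarith
  have hsub : (Finset.Ico s (N / 2)).biUnion
      (fun k => (Finset.box (k + 1) : Finset (ℤ × ℤ))) ⊆ latticeBall (N : ℝ) := by
    intro n hn
    simp only [Finset.mem_biUnion, Finset.mem_Ico] at hn
    obtain ⟨k, ⟨-, hk⟩, hn⟩ := hn
    rw [mem_latticeBall_natCast]
    have h2 : ((2 * (k + 1) : ℕ) : ℝ) ≤ N := by exact_mod_cast (by omega : 2 * (k + 1) ≤ N)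
    have h := (sq_le_normSq_of_mem_box hn).2
    push_cast at h h2
    nlinarith
  have hbox (k : ℕ) (hk : k ∈ Finset.Ico s (N / 2)) : 8 / 3 * ((k + 1 : ℕ) : ℝ)⁻¹ ≤
      ∑ n ∈ Finset.box (α := ℤ × ℤ) (k + 1), 1 / (l + ((n.1 : ℝ) ^ 2 + (n.2 : ℝ) ^ 2)) := by
    have hk0 : (0 : ℝ) < ((k + 1 : ℕ) : ℝ) := by positivity
    have hlk : l ≤ ((k + 1 : ℕ) : ℝ) ^ 2 := by
      refine hlN.trans ?_
      have h2 : s ≤ k := (Finset.mem_Ico.1 hk).1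
      exact_mod_cast (by nlinarith : N ≤ (k + 1) ^ 2)
    refine Eq.trans_le ?_
      (Finset.card_nsmul_le_sum _ _ (1 / (3 * ((k + 1 : ℕ) : ℝ) ^ 2)) fun n hn => ?_)
    · rw [Int.card_box k.succ_ne_zero, nsmul_eq_mul]
      push_cast at hk0 ⊢
      field_simp
    · exact one_div_le_one_div_of_le (by positivity)
        (by linarith [(sq_le_normSq_of_mem_box hn).2])
  have hlog : Real.log N / 4 ≤ ∑ k ∈ Finset.Ico s (N / 2), ((k + 1 : ℕ) : ℝ)⁻¹ := by
    have hupper := harmonic_le_one_add_log s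
    have hlower := log_add_one_le_harmonic (N / 2)
    have hdiff : ∑ k ∈ Finset.Ico s (N / 2), ((k + 1 : ℕ) : ℝ)⁻¹ =
        (harmonic (N / 2) : ℝ) - (harmonic s : ℝ) := by
      rw [Finset.sum_Ico_eq_sub _ h2s, harmonic, harmonic]
      push_cast
      rfl
    have hlogs : 2 * Real.log s ≤ Real.log N := by
      have : Real.log ((s : ℝ) ^ 2) ≤ Real.log N :=
        Real.log_le_log (by positivity) (by exact_mod_cast hsN)
      rwa [Real.log_pow, Nat.cast_ofNat] at this
    have hhalf : Real.log N - Real.log 2 ≤ Real.log ((N / 2 : ℕ) + 1 : ℕ) := by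
      rw [← Real.log_div hN0.ne' two_ne_zero]
      refine Real.log_le_log (by positivity) ?_
      rw [div_le_iff₀ two_pos]
      exact_mod_cast (by omega : N ≤ (N / 2 + 1) * 2)
    rw [hdiff]
    linarith [Real.log_two_lt_d9]
  have hdisj : (Finset.Ico s (N / 2) : Set ℕ).PairwiseDisjoint
      (fun k => (Finset.box (k + 1) : Finset (ℤ × ℤ))) := fun i _ j _ hij =>
    pairwiseDisjoint_box Set.univ (Set.mem_univ (i + 1)) (Set.mem_univ (j + 1)) (by simpa using hij)
  calc 2 / 3 * Real.log N = 8 / 3 * (Real.log N / 4) := by ring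
    _ ≤ 8 / 3 * ∑ k ∈ Finset.Ico s (N / 2), ((k + 1 : ℕ) : ℝ)⁻¹ := by gcongr
    _ ≤ ∑ k ∈ Finset.Ico s (N / 2), ∑ n ∈ Finset.box (α := ℤ × ℤ) (k + 1),
        1 / (l + ((n.1 : ℝ) ^ 2 + (n.2 : ℝ) ^ 2)) := by
        rw [Finset.mul_sum]
        exact Finset.sum_le_sum hbox
    _ = ∑ n ∈ (Finset.Ico s (N / 2)).biUnion (fun k => (Finset.box (k + 1) : Finset (ℤ × ℤ))),
        1 / (l + ((n.1 : ℝ) ^ 2 + (n.2 : ℝ) ^ 2)) :=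
        (Finset.sum_biUnion hdisj).symm
    _ ≤ _ := Finset.sum_le_sum_of_subset_of_nonneg hsub fun _ _ _ => by positivity

theorem stmt3 (α : ℕ → ℝ) (lam : ℕ → ℝ)
    (hbdd : ∃ M : ℝ, ∀ N, |α N| ≤ M)
    (hne : ∀ N, α N ≠ 0)
    (hdiv : Filter.Tendsto (fun N : ℕ => (α N) ^ 2 * Real.log N) Filter.atTop Filter.atTop)
    (hlam : ∀ N : ℕ, 0 < lam N ∧
      lam N = (3 * (α N) ^ 2 / (8 * Real.pi ^ 2)) *
        ∑ n ∈ latticeBall (N : ℝ), 1 / (lam N + ((n.1 : ℝ) ^ 2 + (n.2 : ℝ) ^ 2))) :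
    (∃ c > (0 : ℝ), ∃ C > (0 : ℝ), ∃ N₀ : ℕ, 2 ≤ N₀ ∧ ∀ N, N₀ ≤ N →
      c * (α N) ^ 2 * Real.log N ≤ lam N ∧ lam N ≤ C * (α N) ^ 2 * Real.log N)
    ∧ Filter.Tendsto lam Filter.atTop Filter.atTop := by
  obtain ⟨M, hM⟩ := hbdd
  set A : ℝ := 3 / (8 * Real.pi ^ 2) with hA
  have hA0 : 0 < A := by positivity
  have hA1 : A ≤ 1 := by
    rw [hA, div_le_one (by positivity)]
    nlinarith [Real.pi_gt_three]
  have hM0 : 0 < M := (abs_pos.2 (hne 0)).trans_le (hM 0)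
  have hlogN : Filter.Tendsto (fun N : ℕ => Real.log N) Filter.atTop Filter.atTop :=
    Real.tendsto_log_atTop.comp tendsto_natCast_atTop_atTop
  have hsmall : ∀ᶠ N : ℕ in Filter.atTop, 17 * M ^ 2 * Real.log N ≤ N := by
    have h := (Real.isLittleO_log_id_atTop.bound
      (by positivity : 0 < (17 * M ^ 2)⁻¹)).natCast_atTop
    filter_upwards [h] with N hN
    rw [id, Real.norm_natCast, ← div_eq_inv_mul, le_div_iff₀' (by positivity)] at hN
    exact (mul_le_mul_of_nonneg_left (Real.le_norm_self _) (by positivity)).trans hN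
  have key : ∀ᶠ N : ℕ in Filter.atTop, 2 / 3 * A * (α N) ^ 2 * Real.log N ≤ lam N ∧
      lam N ≤ 17 * (α N) ^ 2 * Real.log N := by
    filter_upwards [hdiv.eventually_ge_atTop 1, hlogN.eventually_ge_atTop 9, hsmall]
      with N h1 h9 hN
    obtain ⟨hpos, heq⟩ := hlam N
    rw [mul_div_right_comm, ← hA] at heq
    have hα : 0 < α N ^ 2 := pow_pos (abs_pos.2 (hne N)) 2 |>.trans_eq (sq_abs _)
    have hαM : α N ^ 2 ≤ M ^ 2 := sq_le_sq' (abs_le.1 (hM N)).1 (abs_le.1 (hM N)).2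
    have hup : lam N ≤ 17 * (α N) ^ 2 * Real.log N := by
      rcases le_total (lam N) 1 with h | h
      · linarith
      · have hS := sum_latticeBall_le (N := N) (lam N) hpos
        have hinv : 1 / lam N ≤ 1 := (div_le_one hpos).2 h
        rw [heq]
        calc _ ≤ A * α N ^ 2 * (17 * Real.log N) := by
              gcongr
              linarith
          _ ≤ 1 * α N ^ 2 * (17 * Real.log N) := by gcongr
          _ = _ := by ring
    refine ⟨?_, hup⟩
    have hlN : lam N ≤ N := hup.trans (le_trans (by gcongr) hN)
    have hS := le_sum_latticeBall (lam N) hpos hlN (by linarith)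
    rw [heq]
    calc _ = A * α N ^ 2 * (2 / 3 * Real.log N) := by ring
      _ ≤ _ := by gcongr
  constructor
  · obtain ⟨N₁, hN₁⟩ := Filter.eventually_atTop.1 key
    exact ⟨2 / 3 * A, by positivity, 17, by norm_num, max 2 N₁, le_max_left _ _,
      fun N hN => hN₁ N ((le_max_right _ _).trans hN)⟩
  · refine Filter.tendsto_atTop_mono' _ (key.mono fun N h => ?_)
      (hdiv.const_mul_atTop (by positivity : 0 < 2 / 3 * A))
    rw [← mul_assoc]
    exact h.1
end

section
/- There exists a constant C > 0 such that for every real number λ ≥ 1 the series ∑_{n ∈ ℤ²} λ / ((λ + |n|²)(1 + |n|²)) converges and satisfies ∑_{n ∈ ℤ²} λ / ((λ + |n|²)(1 + |n|²)) ≤ C·(1 + log λ). -/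
open scoped BigOperators

/-- On the sup-norm sphere of radius `k` the summand is at most its value at radius `k`. -/
lemma lattice_term_le {m : ℝ} (hm : 1 ≤ m) {k : ℕ} {n : ℤ × ℤ}
    (hn : max n.1.natAbs n.2.natAbs = k) :
    m ^ 2 / ((m ^ 2 + ((n.1 : ℝ) ^ 2 + (n.2 : ℝ) ^ 2)) * (1 + ((n.1 : ℝ) ^ 2 + (n.2 : ℝ) ^ 2)))
      ≤ m ^ 2 / ((m ^ 2 + (k : ℝ) ^ 2) * (1 + (k : ℝ) ^ 2)) := by
  have hk : (k : ℝ) ^ 2 ≤ (n.1 : ℝ) ^ 2 + (n.2 : ℝ) ^ 2 := by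
    rcases max_choice n.1.natAbs n.2.natAbs with h | h <;> rw [h] at hn <;> subst hn <;>
      rw [Nat.cast_natAbs, Int.cast_abs, sq_abs] <;> nlinarith [sq_nonneg (n.1 : ℝ), sq_nonneg (n.2 : ℝ)]
  have : 0 < m := by linarith
  gcongr

/-- The contribution of the `k`-th shell is dominated by a telescoping difference. -/
lemma shell_le_telescope {m x : ℝ} (hm : 1 ≤ m) (hx : 0 ≤ x) :
    8 * x * (m ^ 2 / ((m ^ 2 + x ^ 2) * (1 + x ^ 2))) ≤
      64 * ((Real.log (1 + (x + 1)) - Real.log (2 * m + (x + 1))) -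
        (Real.log (1 + x) - Real.log (2 * m + x))) := by
  have hlog : (2 * m - 1) / ((2 + x) * (2 * m + x)) ≤
      (Real.log (1 + (x + 1)) - Real.log (2 * m + (x + 1))) -
        (Real.log (1 + x) - Real.log (2 * m + x)) := by
    have h := Real.one_sub_inv_le_log_of_pos
      (x := ((1 + (x + 1)) * (2 * m + x)) / ((2 * m + (x + 1)) * (1 + x))) (by positivity)
    rw [Real.log_div (by positivity) (by positivity), Real.log_mul (by positivity) (by positivity),
      Real.log_mul (by positivity) (by positivity)] at h
    have e : 1 - (((1 + (x + 1)) * (2 * m + x)) / ((2 * m + (x + 1)) * (1 + x)))⁻¹ =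
        (2 * m - 1) / ((2 + x) * (2 * m + x)) := by
      rw [inv_div, show 1 + (x + 1) = 2 + x by ring]
      field_simp
      ring
    linarith
  have h1 : 8 * x * (m ^ 2 / ((m ^ 2 + x ^ 2) * (1 + x ^ 2))) ≤
      8 * x * (m ^ 2 / (((m + x) ^ 2 / 2) * (1 + x ^ 2))) := by
    gcongr
    nlinarith [sq_nonneg (m - x)]
  have h2 : 8 * x * (m ^ 2 / (((m + x) ^ 2 / 2) * (1 + x ^ 2))) ≤
      16 * (m / (m + x)) * (x / (1 + x ^ 2)) := by
    have e : 8 * x * (m ^ 2 / (((m + x) ^ 2 / 2) * (1 + x ^ 2))) =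
        16 * (m / (m + x)) * (x / (1 + x ^ 2)) * (m / (m + x)) := by
      field_simp
      ring
    rw [e]
    exact mul_le_of_le_one_right (by positivity) ((div_le_one (by positivity)).2 (by linarith))
  have h3 : x / (1 + x ^ 2) ≤ 2 / (2 + x) := by
    rw [div_le_div_iff₀ (by positivity) (by positivity)]
    nlinarith [sq_nonneg (x - 1)]
  have h4 : m / (m + x) ≤ 2 * (2 * m - 1) / (2 * m + x) := by
    rw [div_le_div_iff₀ (by positivity) (by positivity)]
    nlinarith [mul_nonneg (sub_nonneg.2 hm) hx, mul_nonneg (sub_nonneg.2 hm) (sub_nonneg.2 hm)]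
  have h5 : 16 * (m / (m + x)) * (x / (1 + x ^ 2)) ≤
      16 * (2 * (2 * m - 1) / (2 * m + x)) * (2 / (2 + x)) := by
    gcongr
    have : 0 ≤ 2 * m - 1 := by linarith
    positivity
  have h6 : 16 * (2 * (2 * m - 1) / (2 * m + x)) * (2 / (2 + x)) =
      64 * ((2 * m - 1) / ((2 + x) * (2 * m + x))) := by
    field_simp
    ring
  linarith

/-- Partial sums over the sup-norm spheres grow at most logarithmically in `m`. -/
lemma sum_shells_le {m : ℝ} (hm : 1 ≤ m) (N : ℕ) :
    ∑ k ∈ Finset.range N, 8 * (k : ℝ) * (m ^ 2 / ((m ^ 2 + (k : ℝ) ^ 2) * (1 + (k : ℝ) ^ 2))) ≤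
      64 * Real.log (2 * m) := by
  let H : ℕ → ℝ := fun k => Real.log (1 + k) - Real.log (2 * m + k)
  calc _ ≤ ∑ k ∈ Finset.range N, 64 * (H (k + 1) - H k) := by
        refine Finset.sum_le_sum fun k _ => ?_
        simpa [H] using shell_le_telescope hm k.cast_nonneg
    _ = 64 * (H N - H 0) := by rw [← Finset.mul_sum, Finset.sum_range_sub]
    _ ≤ 64 * Real.log (2 * m) := by
        have : Real.log (1 + N) ≤ Real.log (2 * m + N) :=
          Real.log_le_log (by positivity) (by linarith)
        simp only [H, Nat.cast_zero, add_zero, Real.log_one]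
        linarith

lemma sum_box_le {m : ℝ} (hm : 1 ≤ m) (k : ℕ) :
    ∑ n ∈ (Finset.box k : Finset (ℤ × ℤ)),
      m ^ 2 / ((m ^ 2 + ((n.1 : ℝ) ^ 2 + (n.2 : ℝ) ^ 2)) * (1 + ((n.1 : ℝ) ^ 2 + (n.2 : ℝ) ^ 2)))
      ≤ (if k = 0 then 1 else 0) +
        8 * (k : ℝ) * (m ^ 2 / ((m ^ 2 + (k : ℝ) ^ 2) * (1 + (k : ℝ) ^ 2))) := by
  rcases eq_or_ne k 0 with rfl | hk
  · have : m ≠ 0 := by positivity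
    simp [this]
  · refine (Finset.sum_le_card_nsmul _ _ _ fun n hn =>
      lattice_term_le hm (Int.mem_box.1 hn)).trans ?_
    simp [Int.card_box hk, hk]

lemma finset_sum_le {m : ℝ} (hm : 1 ≤ m) (s : Finset (ℤ × ℤ)) :
    ∑ n ∈ s,
      m ^ 2 / ((m ^ 2 + ((n.1 : ℝ) ^ 2 + (n.2 : ℝ) ^ 2)) * (1 + ((n.1 : ℝ) ^ 2 + (n.2 : ℝ) ^ 2)))
      ≤ 1 + 64 * Real.log (2 * m) := by
  let r : ℤ × ℤ → ℕ := fun n => max n.1.natAbs n.2.natAbs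
  let N := s.sup r + 1
  have hr : ∀ n ∈ s, r n ∈ Finset.range N := fun n hn =>
    Finset.mem_range.2 (Nat.lt_succ_of_le (Finset.le_sup hn))
  rw [← Finset.sum_fiberwise_of_maps_to hr]
  calc _ ≤ ∑ k ∈ Finset.range N, ((if k = 0 then (1 : ℝ) else 0) +
        8 * (k : ℝ) * (m ^ 2 / ((m ^ 2 + (k : ℝ) ^ 2) * (1 + (k : ℝ) ^ 2)))) := by
        refine Finset.sum_le_sum fun k _ => le_trans ?_ (sum_box_le hm k)
        refine Finset.sum_le_sum_of_subset_of_nonneg (fun n hn => ?_) fun n _ _ => by positivity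
        exact Int.mem_box.2 (Finset.mem_filter.1 hn).2
    _ ≤ 1 + 64 * Real.log (2 * m) := by
        rw [Finset.sum_add_distrib]
        refine add_le_add ?_ (sum_shells_le hm N)
        simp [N]

theorem stmt5 :
    ∃ C > (0 : ℝ), ∀ lam : ℝ, 1 ≤ lam →
      Summable (fun n : ℤ × ℤ =>
        lam / ((lam + ((n.1 : ℝ) ^ 2 + (n.2 : ℝ) ^ 2)) * (1 + ((n.1 : ℝ) ^ 2 + (n.2 : ℝ) ^ 2)))) ∧
      ∑' n : ℤ × ℤ,
        lam / ((lam + ((n.1 : ℝ) ^ 2 + (n.2 : ℝ) ^ 2)) * (1 + ((n.1 : ℝ) ^ 2 + (n.2 : ℝ) ^ 2)))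
          ≤ C * (1 + Real.log lam) := by
  refine ⟨65, by norm_num, fun lam hlam => ?_⟩
  obtain ⟨m, hm, rfl⟩ : ∃ m : ℝ, 1 ≤ m ∧ m ^ 2 = lam :=
    ⟨√lam, Real.one_le_sqrt.2 hlam, Real.sq_sqrt (by linarith)⟩
  have hnonneg : ∀ n : ℤ × ℤ, 0 ≤ m ^ 2 /
      ((m ^ 2 + ((n.1 : ℝ) ^ 2 + (n.2 : ℝ) ^ 2)) * (1 + ((n.1 : ℝ) ^ 2 + (n.2 : ℝ) ^ 2))) :=
    fun n => by positivity
  refine ⟨summable_of_sum_le hnonneg (finset_sum_le hm),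
    (Real.tsum_le_of_sum_le hnonneg (finset_sum_le hm)).trans ?_⟩
  have hlog2 : Real.log 2 ≤ 1 := by linarith [Real.log_two_lt_d9]
  have hlogm : 0 ≤ Real.log m := Real.log_nonneg hm
  rw [Real.log_mul (by norm_num) (by positivity), Real.log_pow]
  push_cast
  linarith
end

section
/- For every integer ℓ ≥ 1 there exists ε₀ ∈ (0,1) such that for every ε ∈ (0, ε₀] the series ∑_{n₁, …, n_ℓ ∈ ℤ²} (∏_{j=1}^{ℓ−1} (1 + |n_j|²)^{−1}) · (1 + |n_ℓ|²)^{−(2−ε)/2} · (1 + |n₁ + ⋯ + n_ℓ|²)^{−ε} converges (is finite). -/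
open scoped BigOperators

/-- The square `1 + |x|²` of the Japanese bracket of a lattice point `x ∈ ℤ²`. -/
noncomputable def bracketSq (x : ℤ × ℤ) : ℝ := 1 + ((x.1 : ℝ) ^ 2 + (x.2 : ℝ) ^ 2)

lemma bracketSq_pos (x : ℤ × ℤ) : 0 < bracketSq x := by
  unfold bracketSq; positivity

lemma summable_one_add_sq_rpow {p : ℝ} (hp : 1 < p) :
    Summable fun n : ℤ => (1 + (n : ℝ) ^ 2) ^ (-(p / 2)) := by
  refine Summable.of_norm_bounded_eventually (Real.summable_abs_int_rpow hp) ?_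
  filter_upwards [(Set.finite_singleton (0 : ℤ)).compl_mem_cofinite] with n hn
  have hn0 : (n : ℝ) ≠ 0 := by simpa using hn
  rw [Real.norm_of_nonneg (by positivity)]
  calc (1 + (n : ℝ) ^ 2) ^ (-(p / 2)) ≤ (|(n : ℝ)| ^ 2) ^ (-(p / 2)) :=
        Real.rpow_le_rpow_of_nonpos (by positivity) (by rw [sq_abs]; linarith) (by linarith)
    _ = |(n : ℝ)| ^ (-p) := by
        rw [← Real.rpow_natCast, ← Real.rpow_mul (abs_nonneg _)]
        congr 1
        push_cast
        ring

lemma summable_bracketSq_rpow {p : ℝ} (hp : 1 < p) :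
    Summable fun x : ℤ × ℤ => bracketSq x ^ (-p) := by
  have h := (summable_one_add_sq_rpow hp).mul_of_nonneg (summable_one_add_sq_rpow hp)
    (fun n => by positivity) (fun n => by positivity)
  refine h.of_nonneg_of_le (fun x => Real.rpow_nonneg (bracketSq_pos x).le _) fun x => ?_
  have hx := bracketSq_pos x
  calc bracketSq x ^ (-p) = (bracketSq x ^ 2) ^ (-(p / 2)) := by
        rw [← Real.rpow_natCast, ← Real.rpow_mul hx.le]
        congr 1
        push_cast
        ring
    _ ≤ ((1 + (x.1 : ℝ) ^ 2) * (1 + (x.2 : ℝ) ^ 2)) ^ (-(p / 2)) := by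
        refine Real.rpow_le_rpow_of_nonpos (by positivity) ?_ (by linarith)
        unfold bracketSq
        nlinarith [sq_nonneg (x.1 : ℝ), sq_nonneg (x.2 : ℝ),
          mul_nonneg (sq_nonneg (x.1 : ℝ)) (sq_nonneg (x.2 : ℝ)),
          sq_nonneg ((x.1 : ℝ) ^ 2), sq_nonneg ((x.2 : ℝ) ^ 2)]
    _ = _ := Real.mul_rpow (by positivity) (by positivity)

lemma Summable.prod_fin_of_nonneg {α : Type*} {g : α → ℝ} (hg : Summable g) (hg0 : 0 ≤ g)
    (m : ℕ) : Summable fun n : Fin m → α => ∏ j, g (n j) := by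
  induction m with
  | zero => exact Summable.of_finite
  | succ m ih =>
    rw [← (Fin.consEquiv fun _ : Fin (m + 1) => α).summable_iff]
    refine (hg.mul_of_nonneg ih hg0 fun n => Finset.prod_nonneg fun j _ => hg0 _).congr
      fun x => ?_
    simp [Fin.consEquiv, Fin.prod_univ_succ]

lemma update_sum_injective {ι M : Type*} [Fintype ι] [DecidableEq ι] [AddCommGroup M] (i : ι) :
    Function.Injective fun n : ι → M => Function.update n i (∑ j, n j) := by
  intro n m h
  have hne : ∀ j, j ≠ i → n j = m j := fun j hj => by
    simpa [hj] using congrFun h j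
  have hsum : ∑ j, n j = ∑ j, m j := by simpa using congrFun h i
  rw [← Finset.add_sum_erase _ n (Finset.mem_univ i),
    ← Finset.add_sum_erase _ m (Finset.mem_univ i),
    Finset.sum_congr rfl fun j hj => hne j (Finset.ne_of_mem_erase hj)] at hsum
  funext j
  by_cases hj : j = i
  · subst hj
    exact add_right_cancel hsum
  · exact hne j hj

/-- A weighted AM-GM inequality: a product of negative powers of total exponent `p * (card ι - 1)`
is bounded by a convex combination of the products in which one factor is omitted and all the
others have exponent `-p`. -/
lemma prod_rpow_neg_le_sum_prod_erase {ι : Type*} [Fintype ι] [DecidableEq ι] {W a : ι → ℝ}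
    {p : ℝ} (hW : ∀ i, 0 < W i) (hp : 0 < p) (hap : ∀ i, a i ≤ p)
    (ha : ∑ i, a i = p * (Fintype.card ι - 1)) :
    ∏ i, W i ^ (-a i) ≤ ∑ i, (1 - a i / p) * ∏ j ∈ Finset.univ.erase i, W j ^ (-p) := by
  have hP : 0 < ∏ j, W j ^ (-p) := Finset.prod_pos fun j _ => Real.rpow_pos_of_pos (hW j) _
  have hsum : ∑ i, (1 - a i / p) = 1 := by
    rw [Finset.sum_sub_distrib, ← Finset.sum_div, ha, mul_div_cancel_left₀ _ hp.ne']
    simp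
  have herase : ∀ i, ∏ j ∈ Finset.univ.erase i, W j ^ (-p) = (∏ j, W j ^ (-p)) * W i ^ p := by
    intro i
    rw [← Finset.mul_prod_erase _ _ (Finset.mem_univ i), mul_right_comm,
      ← Real.rpow_add (hW i), neg_add_cancel, Real.rpow_zero, one_mul]
  have key := Real.geom_mean_le_arith_mean_weighted Finset.univ (fun i => 1 - a i / p)
    (fun i => ∏ j ∈ Finset.univ.erase i, W j ^ (-p))
    (fun i _ => sub_nonneg.2 ((div_le_one hp).2 (hap i))) hsum
    (fun i _ => Finset.prod_nonneg fun j _ => Real.rpow_nonneg (hW j).le _)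
  refine le_of_eq_of_le ?_ key
  have hfactor : ∀ i, (∏ j ∈ Finset.univ.erase i, W j ^ (-p)) ^ (1 - a i / p) =
      (∏ j, W j ^ (-p)) ^ (1 - a i / p) * W i ^ (p - a i) := by
    intro i
    rw [herase, Real.mul_rpow hP.le (Real.rpow_nonneg (hW i).le _), ← Real.rpow_mul (hW i).le,
      mul_sub, mul_one, mul_div_cancel₀ _ hp.ne']
  simp_rw [hfactor]
  rw [Finset.prod_mul_distrib, ← Real.rpow_sum_of_pos hP, hsum, Real.rpow_one,
    ← Finset.prod_mul_distrib]
  refine Finset.prod_congr rfl fun i _ => ?_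
  rw [← Real.rpow_add (hW i)]
  congr 1
  ring

/-- If the exponents `b` and `c` are at most `p > 1` and sum to `p * m`, the lattice sum of
`∏ j, (1 + |n j|²) ^ (-b j) * (1 + |∑ j, n j|²) ^ (-c)` converges. -/
lemma summable_prod_bracketSq_mul_bracketSq_sum {m : ℕ} {b : Fin m → ℝ} {c p : ℝ} (hp : 1 < p)
    (hb : ∀ j, b j ≤ p) (hc : c ≤ p) (hsum : c + ∑ j, b j = p * m) :
    Summable fun n : Fin m → ℤ × ℤ =>
      (∏ j, bracketSq (n j) ^ (-b j)) * bracketSq (∑ j, n j) ^ (-c) := by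
  have hG : Summable fun n : Fin m → ℤ × ℤ => ∏ j, bracketSq (n j) ^ (-p) :=
    (summable_bracketSq_rpow hp).prod_fin_of_nonneg
      (fun x => Real.rpow_nonneg (bracketSq_pos x).le _) m
  have hbound : Summable fun n : Fin m → ℤ × ℤ =>
      (1 - c / p) * ∏ j, bracketSq (n j) ^ (-p) + ∑ i, (1 - b i / p) *
        ∏ j, bracketSq (Function.update n i (∑ j, n j) j) ^ (-p) :=
    (hG.mul_left _).add <| summable_sum fun i _ =>
      (hG.comp_injective (update_sum_injective i)).mul_left _
  refine hbound.of_nonneg_of_le (fun n => mul_nonneg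
    (Finset.prod_nonneg fun j _ => Real.rpow_nonneg (bracketSq_pos _).le _)
    (Real.rpow_nonneg (bracketSq_pos _).le _)) fun n => ?_
  have key := prod_rpow_neg_le_sum_prod_erase
    (W := fun o : Option (Fin m) => o.elim (bracketSq (∑ j, n j)) fun j => bracketSq (n j))
    (a := fun o => o.elim c b) (p := p)
    (by rintro (_ | j) <;> exact bracketSq_pos _) (by linarith)
    (by rintro (_ | j); exacts [hc, hb j])
    (by simp [Fintype.sum_option, hsum])
  rw [Fintype.prod_option, Fintype.sum_option, mul_comm] at key
  refine key.trans_eq ?_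
  have hnone : (Finset.univ : Finset (Option (Fin m))).erase none =
      Finset.univ.map Function.Embedding.some := by
    ext (_ | j) <;> simp
  have hsome : ∀ i : Fin m, (Finset.univ : Finset (Option (Fin m))).erase (some i) =
      Finset.insertNone (Finset.univ.erase i) := by
    intro i
    ext (_ | j) <;> simp
  congr 1
  · rw [hnone, Finset.prod_map]
    rfl
  · refine Finset.sum_congr rfl fun i _ => ?_
    rw [hsome, Finset.prod_insertNone, ← Finset.mul_prod_erase _ _ (Finset.mem_univ i),
      Function.update_self]
    congr 2
    refine Finset.prod_congr rfl fun j hj => ?_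
    rw [Function.update_of_ne (Finset.ne_of_mem_erase hj)]
    rfl

/- Statement for a general integer `ℓ ≥ 1`, written as `ℓ = k + 1` with `k : ℕ`.
The first `ℓ - 1 = k` coordinates are `n j.castSucc` for `j : Fin k`, and the
last coordinate is `n (Fin.last k)`. -/
theorem stmt11 (k : ℕ) :
    ∃ ε₀ : ℝ, 0 < ε₀ ∧ ε₀ < 1 ∧ ∀ ε : ℝ, 0 < ε → ε ≤ ε₀ →
      Summable (fun n : Fin (k + 1) → ℤ × ℤ =>
        (∏ j : Fin k, (1 + (((n j.castSucc).1 : ℝ) ^ 2 + ((n j.castSucc).2 : ℝ) ^ 2))⁻¹) *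
          (1 + (((n (Fin.last k)).1 : ℝ) ^ 2 + ((n (Fin.last k)).2 : ℝ) ^ 2)) ^ (-((2 - ε) / 2)) *
          (1 + (((∑ j, n j).1 : ℝ) ^ 2 + ((∑ j, n j).2 : ℝ) ^ 2)) ^ (-ε)) := by
  refine ⟨1 / 2, by norm_num, by norm_num, fun ε hε hε₀ => ?_⟩
  have hk : (0 : ℝ) < k + 1 := by positivity
  have hδ : 0 < ε / (2 * (k + 1)) := by positivity
  refine (summable_prod_bracketSq_mul_bracketSq_sum (m := k + 1) (c := ε)
    (p := 1 + ε / (2 * (k + 1))) (b := Fin.snoc (fun _ : Fin k => (1 : ℝ)) ((2 - ε) / 2))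
    (by linarith) ?_ (by linarith) ?_).congr fun n => ?_
  · intro j
    refine Fin.lastCases ?_ (fun i => ?_) j
    · rw [Fin.snoc_last]; linarith
    · rw [Fin.snoc_castSucc]; linarith
  · rw [Fin.sum_univ_castSucc]
    simp only [Fin.snoc_castSucc, Fin.snoc_last, Finset.sum_const, Finset.card_univ,
      Fintype.card_fin, nsmul_eq_mul, mul_one]
    push_cast
    field_simp
    ring
  · rw [Fin.prod_univ_castSucc]
    simp only [Fin.snoc_castSucc, Fin.snoc_last, Real.rpow_neg_one, bracketSq]
end
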